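/- Let 1 < p ≤ 2, 0 < r < p', 0 < s < ∞ and set α = 1/s + 1/p' − 1/r. For every β < α there exists a precompact subset A ⊂ l_p such that (e_n(A))_n ∈ l_{r,s} but (e_n(aco(A)))_n ∉ l_{p',s,β}. -/

import Mathlib

open MeasureTheory

/-- The `n`-th entropy number of a subset `A` of a pseudometric space. -/
noncomputable def entropyNum {X : Type*} [PseudoMetricSpace X] (A : Set X) (n : ℕ) : ℝ :=
  sInf {ε : ℝ | 0 ≤ ε ∧ ∃ T : Finset X, T.card ≤ n ∧ A ⊆ ⋃ x ∈ T, Metric.closedBall x ε}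

/-- The `n`-th dyadic entropy number of a subset `A`. -/
noncomputable def dyadEntropyNum {X : Type*} [PseudoMetricSpace X] (A : Set X) (n : ℕ) : ℝ :=
  entropyNum A (2 ^ (n - 1))

/-- The `n`-th entropy number of a bounded linear operator. -/
noncomputable def opEntropyNum {X Y : Type*} [SeminormedAddCommGroup X] [SeminormedAddCommGroup Y]
    [NormedSpace ℝ X] [NormedSpace ℝ Y] (T : X →L[ℝ] Y) (n : ℕ) : ℝ :=
  entropyNum (T '' Metric.closedBall 0 1) n

/-- The `n`-th dyadic entropy number of a bounded linear operator. -/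
noncomputable def opDyadEntropyNum {X Y : Type*} [SeminormedAddCommGroup X]
    [SeminormedAddCommGroup Y] [NormedSpace ℝ X] [NormedSpace ℝ Y]
    (T : X →L[ℝ] Y) (n : ℕ) : ℝ :=
  opEntropyNum T (2 ^ (n - 1))

/-- The absolutely convex hull of a set: all finite sums `∑ λ i • a i` with `∑ |λ i| ≤ 1`. -/
def absConvHull {X : Type*} [AddCommGroup X] [Module ℝ X] (A : Set X) : Set X :=
  {x | ∃ (n : ℕ) (a : Fin n → X) (lam : Fin n → ℝ),
    (∀ i, a i ∈ A) ∧ (∑ i, |lam i|) ≤ 1 ∧ x = ∑ i, lam i • a i}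

/-- The `i`-th Rademacher function. -/
noncomputable def rademacherFn (i : ℕ) (t : ℝ) : ℝ :=
  Real.sign (Real.sin (2 ^ i * Real.pi * t))

/-- `X` is of type `p` with constant `ρ`. -/
def IsTypePWith (X : Type*) [SeminormedAddCommGroup X] [NormedSpace ℝ X] (p ρ : ℝ) : Prop :=
  ∀ (k : ℕ) (x : Fin k → X),
    (∫ t in (0:ℝ)..1, ‖∑ i : Fin k, rademacherFn (i.1 + 1) t • x i‖) ≤
      ρ * (∑ i : Fin k, ‖x i‖ ^ p) ^ (1 / p)

/-- `X` is a Banach space of type `p`. -/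
def IsTypeP (X : Type*) [SeminormedAddCommGroup X] [NormedSpace ℝ X] (p : ℝ) : Prop :=
  ∃ ρ > 0, IsTypePWith X p ρ

/-- Membership in the generalized Lorentz sequence space `l_{r,s,α}`, `0 < s < ∞`:
`∑_{n ≥ 1} (log₂(n+1))^{-αs} n^{s/r-1} ξ_n^s < ∞`. -/
def MemLorentz (r s α : ℝ) (ξ : ℕ → ℝ) : Prop :=
  Summable fun n : ℕ =>
    (Real.logb 2 ((n : ℝ) + 2)) ^ (-(α * s)) * ((n : ℝ) + 1) ^ (s / r - 1) * ξ (n + 1) ^ s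

/-- Membership in the generalized Lorentz sequence space `l_{r,∞,α}`:
`sup_{n ≥ 1} (log₂(n+1))^{-α} n^{1/r} ξ_n < ∞`. -/
def MemLorentzTop (r α : ℝ) (ξ : ℕ → ℝ) : Prop :=
  ∃ C : ℝ, ∀ n : ℕ, 1 ≤ n →
    (Real.logb 2 ((n : ℝ) + 1)) ^ (-α) * (n : ℝ) ^ (1 / r) * ξ n ≤ C

/-- The `n`-th Kolmogorov number of a bounded linear operator. -/
noncomputable def kolmogorovNum {X Y : Type*} [SeminormedAddCommGroup X] [NormedSpace ℝ X]
    [NormedAddCommGroup Y] [NormedSpace ℝ Y] (T : X →L[ℝ] Y) (n : ℕ) : ℝ :=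
  sInf {c : ℝ | ∃ F : Submodule ℝ Y, Module.rank ℝ F < (n : Cardinal) ∧
    ∀ x ∈ Metric.closedBall (0 : X) 1, Metric.infDist (T x) (F : Set Y) ≤ c}

/-- The `l`-norm of an operator from a finite-dimensional Euclidean space. -/
noncomputable def ellNormFin {Y : Type*} [SeminormedAddCommGroup Y] [NormedSpace ℝ Y] {n : ℕ}
    (S : EuclideanSpace ℝ (Fin n) →L[ℝ] Y) : ℝ :=
  (∫ x : Fin n → ℝ, ‖S ((WithLp.equiv 2 (Fin n → ℝ)).symm x)‖ ^ 2
      ∂(Measure.pi fun _ : Fin n => ProbabilityTheory.gaussianReal 0 1)) ^ ((1 : ℝ) / 2)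

/-- The `l`-norm of an operator between Banach spaces. -/
noncomputable def ellNorm {X Y : Type*} [SeminormedAddCommGroup X] [NormedSpace ℝ X]
    [SeminormedAddCommGroup Y] [NormedSpace ℝ Y] (T : X →L[ℝ] Y) : ℝ :=
  sSup {c : ℝ | ∃ (n : ℕ) (A : EuclideanSpace ℝ (Fin n) →L[ℝ] X),
    ‖A‖ ≤ 1 ∧ c = ellNormFin (T.comp A)}

/-- The `n`-th approximation number of `T` with respect to the `l`-norm. -/
noncomputable def approxNumEll {X Y : Type*} [SeminormedAddCommGroup X] [NormedSpace ℝ X]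
    [SeminormedAddCommGroup Y] [NormedSpace ℝ Y] (T : X →L[ℝ] Y) (n : ℕ) : ℝ :=
  sInf {c : ℝ | ∃ A : X →L[ℝ] Y,
    Module.rank ℝ (LinearMap.range (A : X →ₗ[ℝ] Y)) < (n : Cardinal) ∧ c = ellNorm (T - A)}

section EntropyNumbers

variable {X : Type*} [PseudoMetricSpace X] {A : Set X} {n : ℕ} {ε : ℝ}

lemma entropyNum_nonneg (A : Set X) (n : ℕ) : 0 ≤ entropyNum A n :=
  Real.sInf_nonneg fun _ h => h.1

lemma entropyNum_le (hε : 0 ≤ ε) (T : Finset X) (hT : T.card ≤ n)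
    (h : A ⊆ ⋃ x ∈ T, Metric.closedBall x ε) : entropyNum A n ≤ ε :=
  csInf_le ⟨0, fun _ h => h.1⟩ ⟨hε, T, hT, h⟩

/-- A separated family of more than `n` points bounds the `n`-th entropy number from below. -/
lemma le_entropyNum {ι : Type*} [Fintype ι] (hA : Bornology.IsBounded A) (hn : 1 ≤ n)
    (hcard : n < Fintype.card ι) (x : ι → X) (hx : ∀ i, x i ∈ A)
    (hsep : ∀ i j, i ≠ j → 2 * ε ≤ dist (x i) (x j)) : ε ≤ entropyNum A n := by
  have hι : 0 < Fintype.card ι := by omega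
  obtain ⟨i₀⟩ := Fintype.card_pos_iff.mp hι
  refine le_csInf ?_ ?_
  · obtain ⟨R, hR, h⟩ := hA.subset_closedBall_lt 0 (x i₀)
    exact ⟨R, hR.le, {x i₀}, by simpa using hn, by simpa using h⟩
  · rintro δ ⟨-, T, hT, hcov⟩
    have hc : ∀ i, ∃ y ∈ T, x i ∈ Metric.closedBall y δ := fun i => by
      simpa using hcov (hx i)
    choose c hcT hc using hc
    obtain ⟨i, -, j, -, hij, h⟩ := Finset.exists_ne_map_eq_of_card_lt_of_maps_to
      (s := Finset.univ) (t := T) (f := c) (by rw [Finset.card_univ]; omega)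
      (fun i _ => hcT i)
    have h₁ := hc i
    have h₂ := hc j
    rw [Metric.mem_closedBall] at h₁ h₂
    rw [← h] at h₂
    have := dist_triangle_right (x i) (x j) (c i)
    linarith [hsep i j hij]

end EntropyNumbers

section ReedSolomon

variable {K : Type*} [Field K] [Fintype K] [DecidableEq K]

/-- The polynomial function with the given coefficients. -/
noncomputable def polyCode {d : ℕ} (u : Fin d → K) (x : K) : K :=
  ((Polynomial.degreeLTEquiv K d).symm u).1.eval x

/-- Two distinct polynomials of degree less than `d` differ in at least `card K - d` points. -/
lemma card_polyCode_ne {d : ℕ} {u v : Fin d → K} (huv : u ≠ v) :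
    Fintype.card K ≤ d + (Finset.univ.filter fun x => polyCode u x ≠ polyCode v x).card := by
  by_contra! hlt
  have hsum := Finset.card_filter_add_card_filter_not (s := (Finset.univ : Finset K))
    (fun x => polyCode u x = polyCode v x)
  rw [Finset.card_univ] at hsum
  have hd : d ≤ (Finset.univ.filter fun x => polyCode u x = polyCode v x).card := by
    simp only [ne_eq] at hlt
    omega
  refine huv ((Polynomial.degreeLTEquiv K d).symm.injective (Subtype.ext ?_))
  refine Polynomial.eq_of_degrees_lt_of_eval_finset_eq
    (Finset.univ.filter fun x => polyCode u x = polyCode v x) ?_ ?_ ?_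
  · exact (Polynomial.mem_degreeLT.mp (Subtype.prop _)).trans_le (by exact_mod_cast hd)
  · exact (Polynomial.mem_degreeLT.mp (Subtype.prop _)).trans_le (by exact_mod_cast hd)
  · intro x hx
    exact (Finset.mem_filter.mp hx).2

end ReedSolomon

section WeightedBasis

variable {P : ENNReal} {a : ℕ → ℝ}

/-- The set of the vectors `a k • e k`, where `e k` is the unit vector basis of `ℓ_P`. -/
noncomputable def weightedBasis (P : ENNReal) (a : ℕ → ℝ) : Set (lp (fun _ : ℕ => ℝ) P) :=
  Set.range fun k => lp.single P k (a k)

/-- Averages of unit basis vectors, rescaled by a lower bound for the weights, lie in the hull. -/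
lemma average_mem_absConvHull {ι : Type*} [Fintype ι] [Nonempty ι] (ha0 : ∀ k, 0 < a k)
    {c : ℝ} (hc : 0 ≤ c) (k : ι → ℕ) (hk : ∀ i, c ≤ a (k i)) :
    ∑ i, (lp.single P (k i) (c / Fintype.card ι) : lp (fun _ : ℕ => ℝ) P) ∈ absConvHull (weightedBasis P a) := by
  have hq : (0 : ℝ) < Fintype.card ι := by exact_mod_cast Fintype.card_pos
  let e := (Fintype.equivFin ι).symm
  refine ⟨Fintype.card ι, fun t => lp.single P (k (e t)) (a (k (e t))),
    fun t => c / Fintype.card ι / a (k (e t)), fun t => ⟨_, rfl⟩, ?_, ?_⟩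
  · calc ∑ t, |c / Fintype.card ι / a (k (e t))|
        ≤ ∑ _t : Fin (Fintype.card ι), 1 / (Fintype.card ι : ℝ) := by
          refine Finset.sum_le_sum fun t _ => ?_
          have h := ha0 (k (e t))
          rw [abs_of_nonneg (by positivity), div_right_comm]
          gcongr
          exact (div_le_one h).mpr (hk _)
      _ = 1 := by simp [hq.ne']
  · rw [← e.sum_comp]
    refine Finset.sum_congr rfl fun t _ => ?_
    rw [← lp.single_smul, smul_eq_mul, div_mul_cancel₀ _ (ha0 _).ne']

variable [Fact (1 ≤ P)]

lemma weightedBasis_cover (ha : Antitone a) (ha0 : ∀ k, 0 ≤ a k) (k : ℕ) :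
    ∃ T : Finset (lp (fun _ : ℕ => ℝ) P), T.card ≤ k + 1 ∧
      weightedBasis P a ⊆ ⋃ x ∈ T, Metric.closedBall x (a k) := by
  classical
  have hP : 0 < P := zero_lt_one.trans_le Fact.out
  refine ⟨insert 0 ((Finset.range k).image fun j => lp.single P j (a j)), ?_, ?_⟩
  · refine (Finset.card_insert_le _ _).trans ?_
    have := Finset.card_image_le (s := Finset.range k)
      (f := fun j => (lp.single P j (a j) : lp (fun _ : ℕ => ℝ) P))
    rw [Finset.card_range] at this
    omega
  · rintro _ ⟨j, rfl⟩
    rcases lt_or_ge j k with h | h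
    · refine Set.mem_biUnion (x := lp.single P j (a j)) ?_ (Metric.mem_closedBall_self (ha0 k))
      exact Finset.mem_coe.mpr
        (Finset.mem_insert_of_mem (Finset.mem_image_of_mem _ (Finset.mem_range.mpr h)))
    · refine Set.mem_biUnion (x := 0) (Finset.mem_coe.mpr (Finset.mem_insert_self _ _)) ?_
      rw [mem_closedBall_zero_iff, lp.norm_single hP, Real.norm_of_nonneg (ha0 j)]
      exact ha h

lemma entropyNum_weightedBasis_le (ha : Antitone a) (ha0 : ∀ k, 0 ≤ a k) (k : ℕ) :
    entropyNum (weightedBasis P a) (k + 1) ≤ a k := by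
  obtain ⟨T, hT, h⟩ := weightedBasis_cover (P := P) ha ha0 k
  exact entropyNum_le (ha0 k) T hT h

lemma totallyBounded_weightedBasis (ha : Antitone a) (ha0 : ∀ k, 0 ≤ a k)
    (hlim : Filter.Tendsto a Filter.atTop (nhds 0)) : TotallyBounded (weightedBasis P a) := by
  rw [Metric.totallyBounded_iff]
  intro ε hε
  obtain ⟨k, hk⟩ := (hlim.eventually_lt_const hε).exists
  obtain ⟨T, -, h⟩ := weightedBasis_cover (P := P) ha ha0 k
  refine ⟨T, T.finite_toSet, h.trans ?_⟩
  gcongr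
  exact Metric.closedBall_subset_ball hk

lemma isBounded_absConvHull_weightedBasis (ha : Antitone a) (ha0 : ∀ k, 0 ≤ a k) :
    Bornology.IsBounded (absConvHull (weightedBasis P a)) := by
  have hP : 0 < P := zero_lt_one.trans_le Fact.out
  refine (Metric.isBounded_closedBall (x := 0) (r := a 0)).subset ?_
  rintro _ ⟨n, x, lam, hx, hlam, rfl⟩
  rw [mem_closedBall_zero_iff]
  calc ‖∑ i, lam i • x i‖ ≤ ∑ i, ‖lam i • x i‖ := norm_sum_le _ _
    _ ≤ ∑ i, |lam i| * a 0 := by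
        refine Finset.sum_le_sum fun i _ => ?_
        obtain ⟨j, hj⟩ := hx i
        rw [norm_smul, ← hj, Real.norm_eq_abs, lp.norm_single hP, Real.norm_of_nonneg (ha0 j)]
        exact mul_le_mul_of_nonneg_left (ha (Nat.zero_le j)) (abs_nonneg _)
    _ = (∑ i, |lam i|) * a 0 := by rw [Finset.sum_mul]
    _ ≤ a 0 := mul_le_of_le_one_left (ha0 0) hlam

/-- Two sums of basis vectors over graphs in `K × K` are separated in terms of the number of points
in which the graphs differ. -/
lemma le_dist_graph_sum {K : Type*} [Fintype K] [DecidableEq K] (hP : 0 < P.toReal)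
    {b : ℝ} (hb : 0 ≤ b) {idx : K × K → ℕ} (hidx : Function.Injective idx) (f g : K → K) :
    (Finset.univ.filter fun x => f x ≠ g x).card * b ^ P.toReal ≤
      dist (∑ i, lp.single P (idx (i, f i)) b : lp (fun _ : ℕ => ℝ) P)
        (∑ i, lp.single P (idx (i, g i)) b) ^ P.toReal := by
  set D := Finset.univ.filter fun x => f x ≠ g x
  have hinj : Function.Injective fun i => idx (i, f i) := fun i j h => by
    have := hidx h
    simp only [Prod.mk.injEq] at this
    exact this.1
  have hcoord : ∀ h : K → K, ∀ i j,
      (∑ x, lp.single P (idx (x, h x)) b : lp (fun _ : ℕ => ℝ) P) (idx (i, j)) =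
        if h i = j then b else 0 := by
    intro h i j
    rw [lp.coeFn_sum, Finset.sum_apply, Finset.sum_eq_single i]
    · rw [lp.single_apply, Pi.single_apply]
      congr 1
      simp [hidx.eq_iff, eq_comm]
    · intro x _ hx
      rw [lp.single_apply_ne]
      intro h'
      have := hidx h'
      simp only [Prod.mk.injEq] at this
      exact hx this.1.symm
    · simp
  rw [dist_eq_norm]
  refine le_trans (le_of_eq ?_) (lp.sum_rpow_le_norm_rpow hP _ (D.map ⟨_, hinj⟩))
  rw [Finset.sum_map, ← nsmul_eq_mul, ← Finset.sum_const]
  refine Finset.sum_congr rfl fun i hi => ?_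
  have hi' : f i ≠ g i := (Finset.mem_filter.mp hi).2
  simp only [Function.Embedding.coeFn_mk, lp.coeFn_sub, Pi.sub_apply, hcoord]
  simp [hi'.symm, abs_of_nonneg hb]

/-- Lower entropy bound for the hull, obtained from Reed–Solomon codes over the field with
`2 ^ m` elements. -/
lemma le_dyadEntropyNum_absConvHull {p : ℝ} (hp : 1 ≤ p) (hP : P.toReal = p)
    (ha : Antitone a) (ha0 : ∀ k, 0 < a k) {m n : ℕ} (hm : 1 ≤ m) (hn : 1 ≤ n)
    (hnm : n ≤ m * 2 ^ (m - 1)) :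
    1 / 4 * a (4 ^ m) * ((2 : ℝ) ^ m) ^ (-(1 - 1 / p)) ≤
      dyadEntropyNum (absConvHull (weightedBasis P a)) n := by
  classical
  let K := GaloisField 2 m
  let _ : Fintype K := Fintype.ofFinite K
  have hK : Fintype.card K = 2 ^ m := by
    rw [← Nat.card_eq_fintype_card]
    exact GaloisField.card 2 m (by omega)
  let idx : K × K → ℕ := fun z => Fintype.equivFin (K × K) z
  have hidx : Function.Injective idx :=
    Fin.val_injective.comp (Fintype.equivFin (K × K)).injective
  have hlt : ∀ z, idx z < 4 ^ m := fun z => by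
    have h := (Fintype.equivFin (K × K) z).isLt
    have h4 : Fintype.card (K × K) = 4 ^ m := by
      rw [Fintype.card_prod, hK, ← mul_pow]
      norm_num
    exact h.trans_eq h4
  set c := a (4 ^ m) with hc
  have hc0 : 0 < c := ha0 _
  set d := 2 ^ (m - 1) with hd
  have hdm : 2 ^ m = 2 * d := by
    rw [hd, ← pow_succ', Nat.sub_add_cancel hm]
  set q : ℝ := (2 : ℝ) ^ m with hq
  have hq0 : 0 < q := by positivity
  have hKq : (Fintype.card K : ℝ) = q := by rw [hK, hq]; push_cast; rfl
  have hdq : (d : ℝ) = q / 2 := by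
    have : ((2 ^ m : ℕ) : ℝ) = 2 * d := by rw [hdm]; push_cast; rfl
    push_cast at this
    rw [hq]; linarith
  have hp0 : 0 < p := by linarith
  refine le_entropyNum (ι := Fin d → K)
    (isBounded_absConvHull_weightedBasis ha fun k => (ha0 k).le) Nat.one_le_two_pow ?_
    (fun u => ∑ i, (lp.single P (idx (i, polyCode u i)) (c / Fintype.card K) :
      lp (fun _ : ℕ => ℝ) P)) ?_ ?_
  · rw [Fintype.card_fun, Fintype.card_fin, hK, ← pow_mul]
    exact Nat.pow_lt_pow_right (by norm_num) (by omega)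
  · intro u
    exact average_mem_absConvHull ha0 hc0.le _ fun i => ha (hlt _).le
  · intro u v huv
    have h := le_dist_graph_sum (P := P) (b := c / Fintype.card K) (by rw [hP]; exact hp0)
      (by positivity) hidx (polyCode u) (polyCode v)
    have hcard := card_polyCode_ne huv
    rw [hK, hdm] at hcard
    have hcard' : (d : ℝ) ≤
        (Finset.univ.filter fun x => polyCode u x ≠ polyCode v x).card := by
      rw [Nat.cast_le]
      omega
    rw [hP] at h
    refine (Real.rpow_le_rpow_iff (by positivity) dist_nonneg hp0).mp (le_trans ?_ h)
    refine le_trans ?_ (mul_le_mul_of_nonneg_right hcard' (by positivity))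
    rw [hKq, hdq]
    have h1 : 2 * (1 / 4 * c * q ^ (-(1 - 1 / p))) = (1 / 2) * c * q ^ (-(1 - 1 / p)) := by ring
    rw [h1, Real.mul_rpow (by positivity) (by positivity),
      Real.mul_rpow (by positivity) hc0.le, Real.div_rpow hc0.le hq0.le, ← Real.rpow_mul hq0.le]
    have h2 : -(1 - 1 / p) * p = 1 - p := by field_simp; ring
    rw [h2, Real.rpow_sub hq0, Real.rpow_one]
    have h3 : (1 / 2 : ℝ) ^ p ≤ 1 / 2 := by
      simpa using Real.rpow_le_rpow_of_exponent_ge (by norm_num) (by norm_num) hp (x := 1 / 2)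
    calc (1 / 2 : ℝ) ^ p * c ^ p * (q / q ^ p) ≤ 1 / 2 * c ^ p * (q / q ^ p) := by gcongr
      _ = q / 2 * (c ^ p / q ^ p) := by ring

end WeightedBasis

section LogWeights

/-- The weights `(log₂ (k + 2)) ^ (-τ)`. -/
noncomputable def logWeight (τ : ℝ) (k : ℕ) : ℝ :=
  Real.logb 2 ((k : ℝ) + 2) ^ (-τ)

variable {τ : ℝ}

lemma one_le_logb_add_two (k : ℕ) : 1 ≤ Real.logb 2 ((k : ℝ) + 2) := by
  rw [Real.le_logb_iff_rpow_le (by norm_num) (by positivity), Real.rpow_one]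
  linarith [k.cast_nonneg (α := ℝ)]

lemma logb_add_two_mono : Monotone fun k : ℕ => Real.logb 2 ((k : ℝ) + 2) := fun i j h =>
  Real.logb_le_logb_of_le (by norm_num) (by positivity) (by gcongr)

lemma logWeight_pos (τ : ℝ) (k : ℕ) : 0 < logWeight τ k :=
  Real.rpow_pos_of_pos (zero_lt_one.trans_le (one_le_logb_add_two k)) _

lemma antitone_logWeight (hτ : 0 ≤ τ) : Antitone (logWeight τ) := fun i j h =>
  Real.rpow_le_rpow_of_nonpos (zero_lt_one.trans_le (one_le_logb_add_two i))
    (logb_add_two_mono h) (by linarith)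

lemma tendsto_logWeight (hτ : 0 < τ) :
    Filter.Tendsto (logWeight τ) Filter.atTop (nhds 0) :=
  (tendsto_rpow_neg_atTop hτ).comp <| (Real.tendsto_logb_atTop (by norm_num)).comp <|
    Filter.tendsto_atTop_add_const_right _ _ tendsto_natCast_atTop_atTop

lemma logWeight_two_pow_sub_one_le (hτ : 0 ≤ τ) (n : ℕ) :
    logWeight τ (2 ^ n - 1) ≤ (((n : ℝ) + 1) / 2) ^ (-τ) := by
  refine Real.rpow_le_rpow_of_nonpos (by positivity) ?_ (by linarith)
  have h₁ := one_le_logb_add_two (2 ^ n - 1)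
  have h₂ : (n : ℝ) ≤ Real.logb 2 (((2 ^ n - 1 : ℕ) : ℝ) + 2) := by
    rw [Real.le_logb_iff_rpow_le (by norm_num) (by positivity), Real.rpow_natCast,
      Nat.cast_sub Nat.one_le_two_pow]
    push_cast
    linarith
  linarith

lemma le_logWeight_four_pow (hτ : 0 ≤ τ) {m : ℕ} (hm : 1 ≤ m) :
    (3 * (m : ℝ)) ^ (-τ) ≤ logWeight τ (4 ^ m) := by
  refine Real.rpow_le_rpow_of_nonpos (zero_lt_one.trans_le (one_le_logb_add_two _)) ?_
    (by linarith)
  rw [Real.logb_le_iff_le_rpow (by norm_num) (by positivity), Real.rpow_mul (by norm_num),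
    Real.rpow_natCast]
  norm_num
  have h4 : (4 : ℝ) ≤ 4 ^ m := le_self_pow₀ (by norm_num) (by omega)
  have h2 : (2 : ℝ) ≤ 2 ^ m := le_self_pow₀ (by norm_num) (by omega)
  have h8 : (8 : ℝ) ^ m = 4 ^ m * 2 ^ m := by rw [← mul_pow]; norm_num
  rw [h8]
  nlinarith

/-- Inverting `n ≈ m 2 ^ m` for natural numbers. -/
lemma exists_mul_two_pow_near {n : ℕ} (hn : 1 ≤ n) :
    ∃ m, 1 ≤ m ∧ n ≤ m * 2 ^ (m - 1) ∧ m * 2 ^ m ≤ 8 * n ∧ (m = 1 ∨ 2 ^ (m - 2) ≤ n) := by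
  have hex : ∃ m, n ≤ m * 2 ^ (m - 1) := ⟨n, Nat.le_mul_of_pos_right n (by positivity)⟩
  classical
  obtain ⟨m, hm⟩ : ∃ m, m = Nat.find hex := ⟨_, rfl⟩
  have hspec : n ≤ m * 2 ^ (m - 1) := hm ▸ Nat.find_spec hex
  have hmin : ∀ k < m, k * 2 ^ (k - 1) < n := fun k hk =>
    not_le.mp (Nat.find_min hex (hm ▸ hk))
  match m, hspec, hmin with
  | 0, hspec, _ => omega
  | 1, hspec, _ => exact ⟨1, le_rfl, hspec, by omega, Or.inl rfl⟩
  | k + 2, hspec, hmin =>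
    have h := hmin (k + 1) (by omega)
    simp only [Nat.add_sub_cancel] at h
    refine ⟨k + 2, by omega, hspec, ?_, Or.inr ?_⟩
    · have : 2 ^ (k + 2) = 4 * 2 ^ k := by ring
      rw [this]
      nlinarith [Nat.zero_le (k * 2 ^ k)]
    · simp only [Nat.add_sub_cancel]
      nlinarith [Nat.zero_le (k * 2 ^ k)]

lemma not_summable_inv_mul_logb :
    ¬ Summable fun n : ℕ => (((n : ℝ) + 1) * Real.logb 2 ((n : ℝ) + 2))⁻¹ := by
  have hL : ∀ n : ℕ, 0 < Real.logb 2 ((n : ℝ) + 2) := fun n =>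
    zero_lt_one.trans_le (one_le_logb_add_two n)
  rw [← summable_condensed_iff_of_nonneg]
  · intro h
    have h' := h.mul_left 2
    refine Real.not_summable_one_div_natCast ((summable_nat_add_iff 2).mp
      (Summable.of_nonneg_of_le (fun k => by positivity) (fun k => ?_) h'))
    have hk : Real.logb 2 (((2 ^ k : ℕ) : ℝ) + 2) ≤ k + 2 := by
      rw [Real.logb_le_iff_le_rpow (by norm_num) (by positivity),
        Real.rpow_add (by norm_num), Real.rpow_natCast]
      push_cast
      have : (1 : ℝ) ≤ 2 ^ k := one_le_pow₀ (by norm_num)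
      norm_num
      linarith
    have hk0 := hL (2 ^ k)
    push_cast at hk hk0 ⊢
    have h1 : (1 : ℝ) ≤ 2 ^ k := one_le_pow₀ (by norm_num)
    rw [← div_eq_mul_inv, ← mul_div_assoc, div_le_div_iff₀ (by positivity) (by positivity)]
    have := mul_le_mul_of_nonneg_left hk (by positivity : (0 : ℝ) ≤ 2 ^ k + 1)
    have h3 : ((2 : ℝ) ^ k + 1) * (k + 2) ≤ 2 * 2 ^ k * (k + 2) := by gcongr; linarith
    linarith
  · intro n
    have := hL n
    positivity
  · intro m n _ hmn
    have := hL m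
    have h : Real.logb 2 ((m : ℝ) + 2) ≤ Real.logb 2 ((n : ℝ) + 2) := logb_add_two_mono hmn
    gcongr

lemma exists_le_dyadEntropyNum_absConvHull_logWeight {P : ENNReal} [Fact (1 ≤ P)] {p : ℝ}
    (hp : 1 ≤ p) (hP : P.toReal = p) (hτ : 1 - 1 / p ≤ τ) :
    ∃ C > 0, ∀ n : ℕ,
      C * ((n : ℝ) + 1) ^ (-(1 - 1 / p)) * Real.logb 2 ((n : ℝ) + 2) ^ (1 - 1 / p - τ) ≤
        dyadEntropyNum (absConvHull (weightedBasis P (logWeight τ))) (n + 1) := by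
  have hp0 : 0 < p := by linarith
  obtain ⟨σ, hσ⟩ : ∃ σ, σ = 1 - 1 / p := ⟨_, rfl⟩
  have hσ0 : 0 ≤ σ := by
    rw [hσ, sub_nonneg, div_le_one hp0]
    exact hp
  rw [← hσ] at hτ ⊢
  have hτ0 : 0 ≤ τ := hσ0.trans hτ
  refine ⟨1 / 4 * 3 ^ (-τ) * 8 ^ (-σ) * 3 ^ (σ - τ), by positivity, fun n => ?_⟩
  obtain ⟨m, hm, hnm, hm8, hm2⟩ := exists_mul_two_pow_near (n := n + 1) (by omega)
  refine le_trans ?_ (le_dyadEntropyNum_absConvHull hp hP (antitone_logWeight hτ0)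
    (logWeight_pos τ) hm (by omega) hnm)
  rw [← hσ]
  have hL := one_le_logb_add_two n
  set L := Real.logb 2 ((n : ℝ) + 2)
  have hm0 : (0 : ℝ) < m := by exact_mod_cast hm
  have hmL : (m : ℝ) ≤ 3 * L := by
    rcases hm2 with rfl | h
    · push_cast
      linarith
    · have h' : (m : ℝ) - 2 ≤ L := by
        rcases le_or_gt 2 m with h2 | h2
        · rw [Real.le_logb_iff_rpow_le (by norm_num) (by positivity)]
          have : ((m : ℝ) - 2) = ((m - 2 : ℕ) : ℝ) := by push_cast [h2]; ring
          rw [this, Real.rpow_natCast]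
          have : ((2 ^ (m - 2) : ℕ) : ℝ) ≤ ((n + 1 : ℕ) : ℝ) := by exact_mod_cast h
          push_cast at this
          linarith
        · have : (m : ℝ) < 2 := by exact_mod_cast h2
          linarith
      linarith
  have hq : (2 : ℝ) ^ m ≤ 8 * ((n : ℝ) + 1) / m := by
    rw [le_div_iff₀ hm0]
    have : ((m * 2 ^ m : ℕ) : ℝ) ≤ ((8 * (n + 1) : ℕ) : ℝ) := by exact_mod_cast hm8
    push_cast at this
    linarith
  have hN : (0 : ℝ) < (n : ℝ) + 1 := by positivity
  have h₁ : (8 * ((n : ℝ) + 1) / m) ^ (-σ) ≤ ((2 : ℝ) ^ m) ^ (-σ) :=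
    Real.rpow_le_rpow_of_nonpos (by positivity) hq (by linarith)
  have h₂ : (3 * L) ^ (σ - τ) ≤ (m : ℝ) ^ (σ - τ) :=
    Real.rpow_le_rpow_of_nonpos hm0 hmL (by linarith)
  have h₃ := le_logWeight_four_pow hτ0 hm
  calc 1 / 4 * 3 ^ (-τ) * 8 ^ (-σ) * 3 ^ (σ - τ) * ((n : ℝ) + 1) ^ (-σ) * L ^ (σ - τ)
      = 1 / 4 * 3 ^ (-τ) * (8 ^ (-σ) * ((n : ℝ) + 1) ^ (-σ)) * (3 * L) ^ (σ - τ) := by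
        rw [Real.mul_rpow (by norm_num) (by linarith)]
        ring
    _ ≤ 1 / 4 * 3 ^ (-τ) * (8 ^ (-σ) * ((n : ℝ) + 1) ^ (-σ)) * (m : ℝ) ^ (σ - τ) := by gcongr
    _ = 1 / 4 * (3 * (m : ℝ)) ^ (-τ) * (8 * ((n : ℝ) + 1) / m) ^ (-σ) := by
        rw [Real.div_rpow (by positivity) hm0.le, Real.mul_rpow (by norm_num) hN.le,
          Real.mul_rpow (by norm_num) hm0.le, sub_eq_add_neg, Real.rpow_add hm0,
          Real.rpow_neg hm0.le σ]
        field_simp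
    _ ≤ 1 / 4 * logWeight τ (4 ^ m) * ((2 : ℝ) ^ m) ^ (-σ) := by
        gcongr
        exact mul_nonneg (by norm_num) (logWeight_pos τ _).le

end LogWeights

/-- Optimality: for `1 < p ≤ 2`, `0 < r < p'`, `0 < s < ∞`,
`α = 1/s + 1/p' - 1/r` and any `β < α` there is a precompact `A ⊆ l_p` with
`(e_n(A)) ∈ l_{r,s}` but `(e_n(aco A)) ∉ l_{p',s,β}`. -/
theorem stmt1 (p p' r s α β : ℝ) (hp1 : 1 < p) (hp2 : p ≤ 2)
    (hp' : 1 / p + 1 / p' = 1) (hr0 : 0 < r) (hrp : r < p') (hs : 0 < s)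
    (hα : α = 1 / s + 1 / p' - 1 / r) (hβ : β < α) :
    letI : Fact (1 ≤ ENNReal.ofReal p) := ⟨ENNReal.one_le_ofReal.mpr hp1.le⟩
    ∃ A : Set (lp (fun _ : ℕ => ℝ) (ENNReal.ofReal p)),
      TotallyBounded A ∧
      (MemLorentz r s 0 fun n => dyadEntropyNum A n) ∧
      ¬ MemLorentz p' s β fun n => dyadEntropyNum (absConvHull A) n := by
  have hfact : Fact (1 ≤ ENNReal.ofReal p) := ⟨ENNReal.one_le_ofReal.mpr hp1.le⟩
  have hp0 : 0 < p := by linarith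
  have hσ : 1 - 1 / p = 1 / p' := by linarith
  have hp'0 : 0 < p' := hr0.trans hrp
  have hP : (ENNReal.ofReal p).toReal = p := ENNReal.toReal_ofReal hp0.le
  have hrp' : 1 / p' < 1 / r := one_div_lt_one_div_of_lt hr0 hrp
  obtain ⟨τ, hτ⟩ : ∃ τ, τ = 1 / r + (α - β) := ⟨_, rfl⟩
  have hr1 : 0 < 1 / r := by positivity
  have hτ0 : 0 < τ := by linarith
  have hanti := antitone_logWeight hτ0.le
  have hnn : ∀ k, 0 ≤ logWeight τ k := fun k => (logWeight_pos τ k).le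
  refine ⟨weightedBasis _ (logWeight τ),
    totallyBounded_weightedBasis hanti hnn (tendsto_logWeight hτ0), ?_, ?_⟩
  · have hsum : Summable fun n : ℕ =>
        (1 / 2 : ℝ) ^ (-(τ * s)) * ((n : ℝ) + 1) ^ (-1 - s * (α - β)) := by
      refine Summable.mul_left _ ?_
      have h := (summable_nat_add_iff 1).mpr (Real.summable_nat_rpow (p := -1 - s * (α - β)) |>.mpr
        (by nlinarith))
      simpa using h
    refine Summable.of_nonneg_of_le (fun n => ?_) (fun n => ?_) hsum
    · have := entropyNum_nonneg (weightedBasis (ENNReal.ofReal p) (logWeight τ)) (2 ^ (n + 1 - 1))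
      have h1 := one_le_logb_add_two n
      refine mul_nonneg (mul_nonneg ?_ ?_) (Real.rpow_nonneg this _) <;>
        exact Real.rpow_nonneg (by linarith) _
    · have hN : (0 : ℝ) < (n : ℝ) + 1 := by positivity
      have he : dyadEntropyNum (weightedBasis (ENNReal.ofReal p) (logWeight τ)) (n + 1) ≤
          (((n : ℝ) + 1) / 2) ^ (-τ) := by
        refine le_trans ?_ (logWeight_two_pow_sub_one_le hτ0.le n)
        have h := entropyNum_weightedBasis_le (P := ENNReal.ofReal p) hanti hnn (2 ^ n - 1)
        rwa [Nat.sub_add_cancel Nat.one_le_two_pow] at h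
      have hes := Real.rpow_le_rpow (entropyNum_nonneg _ _) he hs.le
      rw [zero_mul, neg_zero, Real.rpow_zero, one_mul]
      refine (mul_le_mul_of_nonneg_left hes (by positivity)).trans_eq ?_
      rw [← Real.rpow_mul (by positivity), div_eq_mul_one_div ((n : ℝ) + 1) 2,
        Real.mul_rpow hN.le (by norm_num),
        ← mul_assoc, ← Real.rpow_add hN, mul_comm, neg_mul]
      congr 2
      rw [hτ]
      ring
  · intro hmem
    obtain ⟨C, hC, hlow⟩ := exists_le_dyadEntropyNum_absConvHull_logWeight
      (P := ENNReal.ofReal p) (τ := τ) hp1.le hP (by linarith)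
    rw [hσ] at hlow
    refine not_summable_inv_mul_logb ((summable_mul_left_iff (Real.rpow_pos_of_pos hC s).ne').mp
      (Summable.of_nonneg_of_le (fun n => ?_) (fun n => ?_) hmem))
    · have := one_le_logb_add_two n
      positivity
    · have hL := one_le_logb_add_two n
      have hn := hlow n
      set L := Real.logb 2 ((n : ℝ) + 2)
      have hL0 : 0 < L := by linarith
      have hN : (0 : ℝ) < (n : ℝ) + 1 := by positivity
      refine le_trans (le_of_eq ?_)
        (mul_le_mul_of_nonneg_left (Real.rpow_le_rpow (by positivity) hn hs.le) (by positivity))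
      rw [Real.mul_rpow (by positivity) (by positivity), Real.mul_rpow hC.le (by positivity),
        ← Real.rpow_mul hN.le, ← Real.rpow_mul hL0.le]
      have e₁ : L⁻¹ = L ^ (-(β * s)) * L ^ ((1 / p' - τ) * s) := by
        rw [← Real.rpow_add hL0, ← Real.rpow_neg_one]
        congr 1
        rw [hτ, hα]
        field_simp
        ring
      have e₂ : ((n : ℝ) + 1)⁻¹ = ((n : ℝ) + 1) ^ (s / p' - 1) * ((n : ℝ) + 1) ^ (-(1 / p') * s) := by
        rw [← Real.rpow_add hN, ← Real.rpow_neg_one]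
        congr 1
        ring
      rw [mul_inv, e₁, e₂]
      ring
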